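/- arXiv:1103.3862 — 3 statements merged into one kernel-verified Lean document; each statement's English description precedes it below -/
import Mathlib

section
/- Consider the linear infinite system with g_t(x) = ⟨a*_t, x⟩ − b_t for t ∈ T and h = A : X → Y, where A is a surjective continuous linear operator and the coefficient set {a*_t : t ∈ T} is bounded in X*. Let Ω := {x ∈ X : Ax = 0 and ⟨a*_t, x⟩ − b_t ≤ 0 for all t ∈ T} and let x̄ ∈ Ω. If the SSC holds (there exists x̂ with A x̂ = 0 and sup_{t∈T}(⟨a*_t, x̂⟩ − b_t) < 0), then the normal cone of convex analysis satisfies N(x̄; Ω) = ⋂_{ε>0} cl* cone{a*_t : t ∈ T_ε(x̄)} + A*(Y*), where T_ε(x̄) := {t ∈ T : ⟨a*_t, x̄⟩ − b_t ≥ −ε}. -/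
open Filter Topology Set Pointwise

section Defs

variable {X : Type*} [NormedAddCommGroup X] [NormedSpace ℝ X]

/-- The canonical identification of the dual of `X` with its weak* dual. -/
def toWD (p : X →L[ℝ] ℝ) : WeakDual ℝ X := p

/-- The weak* closure of a subset of the dual. -/
def wkClosure (S : Set (X →L[ℝ] ℝ)) : Set (X →L[ℝ] ℝ) :=
  {p | toWD p ∈ closure (toWD '' S)}

/-- A subset of the dual is weak* closed. -/
def IsWeakStarClosed (S : Set (X →L[ℝ] ℝ)) : Prop :=
  IsClosed (toWD '' S)

/-- A subset of `X* × ℝ` is weak* closed. -/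
def IsWeakStarClosedProd (S : Set ((X →L[ℝ] ℝ) × ℝ)) : Prop :=
  IsClosed ((fun p : (X →L[ℝ] ℝ) × ℝ => (toWD p.1, p.2)) '' S)

/-- The convex conic hull of `S ∪ {0}`: all finite nonnegative combinations of elements of `S`. -/
def coneHull {E : Type*} [AddCommMonoid E] [Module ℝ E] (S : Set E) : Set E :=
  {x | ∃ (n : ℕ) (c : Fin n → ℝ) (v : Fin n → E),
    (∀ i, 0 ≤ c i) ∧ (∀ i, v i ∈ S) ∧ x = ∑ i, c i • v i}

/-- The set of ε-normals to `Ω` at `x`. -/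
def epsNormal (Ω : Set X) (x : X) (ε : ℝ) : Set (X →L[ℝ] ℝ) :=
  {p | ∀ γ > (0:ℝ), ∃ δ > (0:ℝ), ∀ u ∈ Ω, ‖u - x‖ < δ → p (u - x) ≤ (ε + γ) * ‖u - x‖}

/-- The Fréchet (regular) normal cone to `Ω` at `x`. -/
def frechetNormal (Ω : Set X) (x : X) : Set (X →L[ℝ] ℝ) := epsNormal Ω x 0

/-- The limiting (Mordukhovich) normal cone to `Ω` at `xb`. -/
def limitingNormal (Ω : Set X) (xb : X) : Set (X →L[ℝ] ℝ) :=
  {p | ∃ (ε : ℕ → ℝ) (xs : ℕ → X) (ps : ℕ → X →L[ℝ] ℝ),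
    (∀ n, 0 ≤ ε n) ∧ Tendsto ε atTop (𝓝 0) ∧
    (∀ n, xs n ∈ Ω) ∧ Tendsto xs atTop (𝓝 xb) ∧
    (∀ n, ps n ∈ epsNormal Ω (xs n) (ε n)) ∧
    (∀ v : X, Tendsto (fun n => ps n v) atTop (𝓝 (p v)))}

/-- The normal cone of convex analysis to `Ω` at `xb`. -/
def convexNormal (Ω : Set X) (xb : X) : Set (X →L[ℝ] ℝ) :=
  {p | ∀ x ∈ Ω, p (x - xb) ≤ 0}

/-- The subdifferential of convex analysis of `f` at `xb`. -/
def convexSubdiff (f : X → ℝ) (xb : X) : Set (X →L[ℝ] ℝ) :=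
  {p | ∀ x, f xb + p (x - xb) ≤ f x}

variable {Y : Type*} [NormedAddCommGroup Y] [NormedSpace ℝ Y]

/-- The image `A*(Y*)` of the adjoint operator `A* : Y* → X*`. -/
def adjRange (A : X →L[ℝ] Y) : Set (X →L[ℝ] ℝ) :=
  Set.range fun q : Y →L[ℝ] ℝ => q.comp A

variable {T : Type*}

/-- Uniform Fréchet differentiability of the family `g = (g t)` at `xb`:
`s(η) := sup_t sup_{x ∈ B_η(xb), x ≠ xb} |g t x - g t xb - ⟨dg t, x - xb⟩|/‖x - xb‖ → 0` as `η ↓ 0`. -/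
def UnifFrechetDiffAt (g : T → X → ℝ) (dg : T → X →L[ℝ] ℝ) (xb : X) : Prop :=
  ∀ ε > (0:ℝ), ∃ η > (0:ℝ), ∀ t : T, ∀ x : X, ‖x - xb‖ ≤ η →
    |g t x - g t xb - dg t (x - xb)| ≤ ε * ‖x - xb‖

/-- Uniform strict differentiability of the family `g = (g t)` at `xb`:
`r(η) := sup_t sup_{x,x' ∈ B_η(xb), x ≠ x'} |g t x - g t x' - ⟨dg t, x - x'⟩|/‖x - x'‖ → 0`
as `η ↓ 0`. -/
def UnifStrictDiffAt (g : T → X → ℝ) (dg : T → X →L[ℝ] ℝ) (xb : X) : Prop :=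
  ∀ ε > (0:ℝ), ∃ η > (0:ℝ), ∀ t : T, ∀ x x' : X, ‖x - xb‖ ≤ η → ‖x' - xb‖ ≤ η →
    |g t x - g t x' - dg t (x - x')| ≤ ε * ‖x - x'‖

/-- The inequality part of the PMFCQ at `xb` with the direction `xt`:
`inf_{ε>0} sup_{t ∈ T_ε(xb)} ⟨dg t, xt⟩ < 0`, where `T_ε(xb) = {t | g t xb ≥ -ε}`. -/
def PMFCQat (g : T → X → ℝ) (dg : T → X →L[ℝ] ℝ) (xb xt : X) : Prop :=
  ∃ ε > (0:ℝ), ∃ δ > (0:ℝ), ∀ t : T, -ε ≤ g t xb → dg t xt ≤ -δ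

end Defs

theorem aux_sep {X : Type*} [NormedAddCommGroup X] [NormedSpace ℝ X]
    (S : Set (WeakDual ℝ X)) (hc : Convex ℝ S) (hcl : IsClosed S) (p : WeakDual ℝ X)
    (hp : p ∉ S) : ∃ (u : X) (s : ℝ), (∀ q ∈ S, q u < s) ∧ s < p u := by
  have : LocallyConvexSpace ℝ (WeakDual ℝ X) :=
    inferInstanceAs (LocallyConvexSpace ℝ (WeakBilin (topDualPairing ℝ X)))
  obtain ⟨f, s, h1, h2⟩ := geometric_hahn_banach_closed_point hc hcl hp
  obtain ⟨u, hu⟩ := LinearMap.dualEmbedding_surjective (topDualPairing ℝ X) f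
  have key : ∀ q : WeakDual ℝ X, f q = q u := fun q => by
    rw [← hu]; rfl
  refine ⟨u, s, fun q hq => ?_, ?_⟩
  · rw [← key]; exact h1 q hq
  · rw [← key]; exact h2

theorem aux_coneHull_convex {E : Type*} [AddCommGroup E] [Module ℝ E] (S : Set E) :
    Convex ℝ (coneHull S) := by
  rintro x ⟨n, c, v, hc, hv, rfl⟩ y ⟨m, d, w, hd, hw, rfl⟩ α β hα hβ -
  refine ⟨n + m, Fin.append (fun i => α * c i) (fun i => β * d i), Fin.append v w, ?_, ?_, ?_⟩
  · intro i
    refine Fin.addCases (fun i => ?_) (fun i => ?_) i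
    · simpa using mul_nonneg hα (hc i)
    · simpa using mul_nonneg hβ (hd i)
  · intro i
    refine Fin.addCases (fun i => ?_) (fun i => ?_) i
    · simpa using hv i
    · simpa using hw i
  · simp [Fin.sum_univ_add, Finset.smul_sum, mul_smul]

theorem aux_zero_mem {E : Type*} [AddCommGroup E] [Module ℝ E] (S : Set E) :
    (0 : E) ∈ coneHull S :=
  ⟨0, Fin.elim0, Fin.elim0, fun i => i.elim0, fun i => i.elim0, by simp⟩

theorem aux_smul_mem {E : Type*} [AddCommGroup E] [Module ℝ E] (S : Set E) (k : ℝ) (hk : 0 ≤ k)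
    (v : E) (hv : v ∈ S) : k • v ∈ coneHull S :=
  ⟨1, fun _ => k, fun _ => v, fun _ => hk, fun _ => hv, by simp⟩

theorem aux_coneHull_mono {E : Type*} [AddCommGroup E] [Module ℝ E] {S S' : Set E} (h : S ⊆ S') :
    coneHull S ⊆ coneHull S' := by
  rintro x ⟨n, c, v, hc, hv, rfl⟩
  exact ⟨n, c, v, hc, fun i => h (hv i), rfl⟩

theorem aux_wk_le {X : Type*} [NormedAddCommGroup X] [NormedSpace ℝ X]
    (S : Set (X →L[ℝ] ℝ)) (u : X) (hu : ∀ v ∈ S, v u ≤ 0) (q : X →L[ℝ] ℝ)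
    (hq : q ∈ wkClosure (coneHull S)) : q u ≤ 0 := by
  have hcl : IsClosed {r : WeakDual ℝ X | r u ≤ 0} :=
    isClosed_le (WeakDual.eval_continuous u) continuous_const
  refine closure_minimal ?_ hcl hq
  rintro _ ⟨_, ⟨n, c, v, hc, hv, rfl⟩, rfl⟩
  change (∑ i, c i • v i : X →L[ℝ] ℝ) u ≤ 0
  rw [ContinuousLinearMap.sum_apply]
  refine Finset.sum_nonpos fun i _ => ?_
  exact mul_nonpos_of_nonneg_of_nonpos (hc i) (hu _ (hv i))

theorem aux_range {X Y : Type*} [NormedAddCommGroup X] [NormedSpace ℝ X] [CompleteSpace X]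
    [NormedAddCommGroup Y] [NormedSpace ℝ Y] [CompleteSpace Y] (A : X →L[ℝ] Y)
    (hsurj : Function.Surjective A) (r : X →L[ℝ] ℝ) (hr : ∀ x, A x = 0 → r x = 0) :
    r ∈ adjRange A := by
  have hwd : ∀ x x', A x = A x' → r x = r x' := fun x x' h => by
    have := hr (x - x') (by simp [h])
    rw [map_sub] at this
    linarith
  obtain ⟨C, hC, hpre⟩ := A.exists_preimage_norm_le hsurj
  choose g hg hgn using hpre
  let l : Y →ₗ[ℝ] ℝ :=
    { toFun := fun y => r (g y)
      map_add' := fun y z => by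
        rw [← map_add]; apply hwd; simp [hg]
      map_smul' := fun k y => by
        rw [RingHom.id_apply, ← map_smul]; apply hwd; simp [hg] }
  refine ⟨l.mkContinuous (‖r‖ * C) fun y => ?_, ?_⟩
  · change ‖r (g y)‖ ≤ _
    calc ‖r (g y)‖ ≤ ‖r‖ * ‖g y‖ := r.le_opNorm _
      _ ≤ ‖r‖ * (C * ‖y‖) := by gcongr; exact hgn y
      _ = _ := by ring
  · ext x
    change r (g (A x)) = r x
    exact hwd _ _ (hg _)

/-- The annihilator of the kernel of `A` in the weak* dual. -/
def auxAnn {X Y : Type*} [NormedAddCommGroup X] [NormedSpace ℝ X]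
    [NormedAddCommGroup Y] [NormedSpace ℝ Y] (A : X →L[ℝ] Y) : Set (WeakDual ℝ X) :=
  {r | ∀ x, A x = 0 → r x = 0}

theorem aux_ann_closed {X Y : Type*} [NormedAddCommGroup X] [NormedSpace ℝ X]
    [NormedAddCommGroup Y] [NormedSpace ℝ Y] (A : X →L[ℝ] Y) : IsClosed (auxAnn A) := by
  have : auxAnn A = ⋂ (x : X) (_ : A x = 0), {r : WeakDual ℝ X | r x = 0} := by
    ext r; simp [auxAnn]
  rw [this]
  exact isClosed_iInter fun x => isClosed_iInter fun _ =>
    isClosed_eq (WeakDual.eval_continuous x) continuous_const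

theorem aux_ann_convex {X Y : Type*} [NormedAddCommGroup X] [NormedSpace ℝ X]
    [NormedAddCommGroup Y] [NormedSpace ℝ Y] (A : X →L[ℝ] Y) : Convex ℝ (auxAnn A) := by
  intro r hr s hs α β _ _ _ x hx
  change α * r x + β * s x = 0
  rw [hr x hx, hs x hx]; simp

/-- Bounded part of the weak* closed cone. -/
def auxD {X : Type*} [NormedAddCommGroup X] [NormedSpace ℝ X]
    (S : Set (X →L[ℝ] ℝ)) (R : ℝ) : Set (WeakDual ℝ X) :=
  closure (toWD '' coneHull S) ∩ (WeakDual.toStrongDual ⁻¹' Metric.closedBall 0 R)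

theorem aux_D_compact {X : Type*} [NormedAddCommGroup X] [NormedSpace ℝ X]
    (S : Set (X →L[ℝ] ℝ)) (R : ℝ) : IsCompact (auxD S R) :=
  (WeakDual.isCompact_closedBall 0 R).inter_left isClosed_closure

theorem aux_D_convex {X : Type*} [NormedAddCommGroup X] [NormedSpace ℝ X]
    (S : Set (X →L[ℝ] ℝ)) (R : ℝ) : Convex ℝ (auxD S R) := by
  apply Convex.inter
  · apply Convex.closure
    exact (aux_coneHull_convex S).linear_image
      (StrongDual.toWeakDual : StrongDual ℝ X ≃ₗ[ℝ] WeakDual ℝ X).toLinearMap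
  · exact (convex_closedBall (0 : StrongDual ℝ X) R).linear_preimage
      (WeakDual.toStrongDual : WeakDual ℝ X ≃ₗ[ℝ] StrongDual ℝ X).toLinearMap

theorem aux_D_mem {X : Type*} [NormedAddCommGroup X] [NormedSpace ℝ X]
    (S : Set (X →L[ℝ] ℝ)) (R : ℝ) (q : X →L[ℝ] ℝ) (hq : q ∈ coneHull S) (hR : ‖q‖ ≤ R) :
    toWD q ∈ auxD S R := by
  refine ⟨subset_closure ⟨q, hq, rfl⟩, ?_⟩
  change q ∈ Metric.closedBall 0 R
  simpa using hR

theorem aux_nonempty {X Y T : Type*} [NormedAddCommGroup X] [NormedSpace ℝ X]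
    [NormedAddCommGroup Y] [NormedSpace ℝ Y]
    (a : T → X →L[ℝ] ℝ) (b : T → ℝ) (A : X →L[ℝ] Y) (xb : X) (M : ℝ)
    (hM : ∀ t : T, ‖a t‖ ≤ M) (hM0 : 0 < M)
    (hAxb : A xb = 0) (hxb : ∀ t : T, a t xb - b t ≤ 0)
    (xh : X) (hAxh : A xh = 0) (δ : ℝ) (hδ : 0 < δ) (hxh : ∀ t : T, a t xh - b t ≤ -δ)
    (p : X →L[ℝ] ℝ) (hp : ∀ x, A x = 0 → (∀ t, a t x - b t ≤ 0) → p (x - xb) ≤ 0)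
    (ε : ℝ) (hε : 0 < ε) (hεδ : ε ≤ δ / 2) :
    ∃ q ∈ auxD (a '' {t : T | -ε ≤ a t xb - b t}) ((-2 * p (xh - xb) / δ + 1) * M),
      toWD p - q ∈ auxAnn A := by
  set K : ℝ := -2 * p (xh - xb) / δ + 1 with hK
  have hd : p (xh - xb) ≤ 0 := hp xh hAxh fun t => (hxh t).trans (by linarith)
  have hK1 : 1 ≤ K := by
    have : 0 ≤ -2 * p (xh - xb) / δ := div_nonneg (by linarith) hδ.le
    linarith
  -- the polar inclusion
  have hpol : ∀ u, A u = 0 → (∀ t, -ε ≤ a t xb - b t → a t u ≤ 0) → p u ≤ 0 := by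
    intro u hu htu
    set s : ℝ := ε / (M * (‖u‖ + 1)) with hs
    have hu1 : 0 < ‖u‖ + 1 := by positivity
    have hs0 : 0 < s := by positivity
    have h := hp (xb + s • u) (by simp [hAxb, hu]) fun t => by
      rw [map_add, map_smul, smul_eq_mul]
      by_cases ht : -ε ≤ a t xb - b t
      · have := mul_nonpos_of_nonneg_of_nonpos hs0.le (htu t ht)
        linarith [hxb t]
      · have h1 : a t u ≤ M * (‖u‖ + 1) := by
          calc a t u ≤ ‖a t u‖ := le_abs_self _
            _ ≤ ‖a t‖ * ‖u‖ := (a t).le_opNorm u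
            _ ≤ M * (‖u‖ + 1) := by
              apply mul_le_mul (hM t) (by linarith) (norm_nonneg _) hM0.le
        have h2 : s * a t u ≤ ε := by
          calc s * a t u ≤ s * (M * (‖u‖ + 1)) := by gcongr
            _ = ε := by rw [hs]; field_simp
        linarith
    rw [add_sub_cancel_left, map_smul, smul_eq_mul] at h
    exact nonpos_of_mul_nonpos_right h hs0
  set S := a '' {t : T | -ε ≤ a t xb - b t} with hS
  by_contra hcon
  have hnot : toWD p ∉ auxD S (K * M) + auxAnn A := by
    rintro ⟨q, hq, r, hr, hqr⟩
    refine hcon ⟨q, hq, ?_⟩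
    have : toWD p - q = r := by rw [← hqr]; simp
    rwa [this]
  have hclosed : IsClosed (auxD S (K * M) + auxAnn A) :=
    (aux_ann_closed A).add_left_of_isCompact (aux_D_compact S (K * M))
  obtain ⟨u, s, hus, hps⟩ := aux_sep _ ((aux_D_convex S (K * M)).add (aux_ann_convex A)) hclosed
    (toWD p) hnot
  change s < p u at hps
  have h0D : toWD 0 ∈ auxD S (K * M) :=
    aux_D_mem _ _ 0 (aux_zero_mem _) (by rw [norm_zero]; positivity)
  have h0A : (0 : WeakDual ℝ X) ∈ auxAnn A := fun x _ => rfl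
  have hAu : A u = 0 := by
    rw [SeparatingDual.eq_zero_iff_forall_dual_eq_zero (R := ℝ)]
    intro y
    by_contra hy
    have h := hus _ (Set.add_mem_add h0D
      (show toWD ((s / y (A u)) • (y.comp A)) ∈ auxAnn A from fun x hx => by
        change (s / y (A u)) * y (A x) = 0
        rw [hx]; simp))
    change (0 : ℝ) + (s / y (A u)) * y (A u) < s at h
    rw [div_mul_cancel₀ _ hy] at h
    linarith
  have hs0 : 0 < s := by
    have h := hus _ (Set.add_mem_add h0D h0A)
    change (0 : ℝ) + 0 < s at h
    linarith
  have hat : ∀ t, -ε ≤ a t xb - b t → K * a t u < s := by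
    intro t ht
    have h := hus _ (Set.add_mem_add (aux_D_mem S (K * M) (K • a t)
      (aux_smul_mem _ _ (by linarith) _ ⟨t, ht, rfl⟩) (by
        rw [norm_smul, Real.norm_of_nonneg (by linarith)]
        gcongr
        exact hM t)) h0A)
    change K * a t u + 0 < s at h
    linarith
  set m := s / K with hm
  have hK0 : 0 < K := by linarith
  have hm0 : 0 < m := by positivity
  have hKm : K * m = s := by rw [hm]; field_simp
  have h := hpol (u + (2 * m / δ) • (xh - xb)) (by simp [hAu, hAxh, hAxb]) fun t ht => by
    rw [map_add, map_smul, smul_eq_mul, map_sub]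
    have h1 : a t u ≤ m := by
      rw [hm, le_div_iff₀ hK0]; linarith [hat t ht]
    have h2 : a t xh - a t xb ≤ -(δ / 2) := by linarith [hxh t]
    have h3 : (2 * m / δ) * (a t xh - a t xb) ≤ (2 * m / δ) * (-(δ / 2)) := by gcongr
    have h4 : (2 * m / δ) * (-(δ / 2)) = -m := by field_simp
    linarith
  rw [map_add, map_smul, smul_eq_mul] at h
  have h5 : 2 * m / δ * p (xh - xb) = -((K - 1) * m) := by rw [hK]; ring
  rw [h5] at h
  nlinarith

/-- linear infinite systems, first part: for `g t x = ⟨a t, x⟩ - b t`, `h = A`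
a surjective continuous linear operator, with `{a t : t ∈ T}` bounded in `X*`, the SSC implies
that the normal cone of convex analysis to `Ω = {x | A x = 0, ⟨a t, x⟩ ≤ b t ∀ t}` at `xb ∈ Ω`
is `⋂_{ε>0} cl* cone{a t : t ∈ T_ε(xb)} + A*(Y*)`. -/
theorem statement15 {X Y T : Type*} [NormedAddCommGroup X] [NormedSpace ℝ X] [CompleteSpace X]
    [NormedAddCommGroup Y] [NormedSpace ℝ Y] [CompleteSpace Y]
    (a : T → X →L[ℝ] ℝ) (b : T → ℝ) (A : X →L[ℝ] Y) (xb : X)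
    (hbd : ∃ M : ℝ, ∀ t : T, ‖a t‖ ≤ M)
    (hsurj : Function.Surjective A)
    (hxb : xb ∈ {x : X | A x = 0 ∧ ∀ t : T, a t x - b t ≤ 0})
    (hssc : ∃ xh : X, A xh = 0 ∧ ∃ δ > (0:ℝ), ∀ t : T, a t xh - b t ≤ -δ) :
    convexNormal {x : X | A x = 0 ∧ ∀ t : T, a t x - b t ≤ 0} xb =
      (⋂ ε > (0:ℝ), wkClosure (coneHull (a '' {t : T | -ε ≤ a t xb - b t}))) + adjRange A := by
  obtain ⟨M₀, hM₀⟩ := hbd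
  obtain ⟨xh, hAxh, δ, hδ, hxh⟩ := hssc
  obtain ⟨hAxb, hxb⟩ := hxb
  set M := max M₀ 1 with hMdef
  have hM : ∀ t, ‖a t‖ ≤ M := fun t => (hM₀ t).trans (le_max_left _ _)
  have hM0 : 0 < M := lt_of_lt_of_le one_pos (le_max_right _ _)
  apply Set.Subset.antisymm
  · intro p hp
    have hp' : ∀ x, A x = 0 → (∀ t, a t x - b t ≤ 0) → p (x - xb) ≤ 0 :=
      fun x h1 h2 => hp x ⟨h1, h2⟩
    set R := (-2 * p (xh - xb) / δ + 1) * M with hR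
    let F : {ε : ℝ // 0 < ε} → Set (WeakDual ℝ X) := fun ε =>
      auxD (a '' {t : T | -ε.1 ≤ a t xb - b t}) R ∩ (fun q => toWD p - q) ⁻¹' auxAnn A
    have hmono : ∀ ε ε' : {ε : ℝ // 0 < ε}, ε.1 ≤ ε'.1 → F ε ⊆ F ε' := by
      intro ε ε' h q hq
      refine ⟨⟨closure_mono (image_mono (aux_coneHull_mono (image_mono ?_))) hq.1.1, hq.1.2⟩, hq.2⟩
      intro t ht
      change -ε'.1 ≤ _
      have : -ε.1 ≤ a t xb - b t := ht
      linarith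
    have hann : IsClosed ((fun q : WeakDual ℝ X => toWD p - q) ⁻¹' auxAnn A) :=
      (aux_ann_closed A).preimage (continuous_const.sub continuous_id)
    have hcomp : ∀ ε, IsCompact (F ε) := fun ε => (aux_D_compact _ _).inter_right hann
    have : Nonempty {ε : ℝ // 0 < ε} := ⟨⟨1, one_pos⟩⟩
    obtain ⟨q, hq⟩ := IsCompact.nonempty_iInter_of_directed_nonempty_isCompact_isClosed F
      (fun ε ε' => ⟨⟨min ε.1 ε'.1, lt_min ε.2 ε'.2⟩, hmono _ _ (min_le_left _ _),
        hmono _ _ (min_le_right _ _)⟩)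
      (fun ε => by
        obtain ⟨q, hq, hq'⟩ := aux_nonempty a b A xb M hM hM0 hAxb hxb xh hAxh δ hδ hxh p hp'
          (min ε.1 (δ / 2)) (lt_min ε.2 (by linarith)) (min_le_right _ _)
        exact ⟨q, hmono ⟨min ε.1 (δ / 2), lt_min ε.2 (by linarith)⟩ ε (min_le_left _ _)
          ⟨hq, hq'⟩⟩)
      hcomp (fun ε => (hcomp ε).isClosed)
    rw [Set.mem_iInter] at hq
    let q' : X →L[ℝ] ℝ := WeakDual.toStrongDual q
    refine ⟨q', ?_, p - q', aux_range A hsurj _ ?_, by simp⟩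
    · simp only [Set.mem_iInter]
      intro ε hε
      exact (hq ⟨ε, hε⟩).1.1
    · exact (hq ⟨1, one_pos⟩).2
  · rintro _ ⟨q, hq, _, ⟨y, rfl⟩, rfl⟩ x ⟨hAx, hx⟩
    simp only [Set.mem_iInter] at hq
    change q (x - xb) + y (A (x - xb)) ≤ 0
    rw [map_sub A, hAx, hAxb, sub_self, map_zero, add_zero]
    have key : ∀ ε, 0 < ε → ε ≤ δ / 2 → q (x - xb) + (2 * ε / δ) * q (xh - xb) ≤ 0 := by
      intro ε hε hεδ
      have h := aux_wk_le _ (x - xb + (2 * ε / δ) • (xh - xb)) ?_ q (hq ε hε)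
      · simpa only [map_add, map_smul, smul_eq_mul] using h
      rintro _ ⟨t, ht, rfl⟩
      have ht' : -ε ≤ a t xb - b t := ht
      rw [map_add, map_smul, smul_eq_mul, map_sub, map_sub]
      have h2 : a t xh - a t xb ≤ -(δ / 2) := by linarith [hxh t]
      have h3 : (2 * ε / δ) * (a t xh - a t xb) ≤ (2 * ε / δ) * (-(δ / 2)) := by gcongr
      have h4 : (2 * ε / δ) * (-(δ / 2)) = -ε := by field_simp
      linarith [hx t]
    have hlim : Tendsto (fun ε : ℝ => q (x - xb) + (2 * ε / δ) * q (xh - xb)) (𝓝[>] 0)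
        (𝓝 (q (x - xb))) := by
      have hc : Continuous (fun ε : ℝ => q (x - xb) + (2 * ε / δ) * q (xh - xb)) := by fun_prop
      have := (hc.tendsto 0).mono_left (nhdsWithin_le_nhds (s := Set.Ioi 0))
      simpa using this
    refine le_of_tendsto hlim ?_
    filter_upwards [Ioc_mem_nhdsGT (show (0:ℝ) < δ / 2 by linarith)] with ε hε
    exact key ε hε.1 hε.2
end

section
/- Consider the linear infinite inequality system Ω := {x ∈ X : ⟨a*_t, x⟩ − b_t ≤ 0 for all t ∈ T} (no equality constraints), with {a*_t : t ∈ T} bounded in X*, and let x̄ ∈ Ω. If the cone cone{(a*_t, b_t) : t ∈ T} is weak* closed in X* × ℝ, then the normal cone of convex analysis satisfies N(x̄; Ω) = cone{a*_t : t ∈ T(x̄)}, where T(x̄) := {t ∈ T : ⟨a*_t, x̄⟩ = b_t}. -/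
open Filter Topology Set Pointwise

theorem coneHull_zero {E : Type*} [AddCommMonoid E] [Module ℝ E] (S : Set E) :
    (0 : E) ∈ coneHull S :=
  ⟨0, fun _ => 0, Fin.elim0, by simp, fun i => i.elim0, by simp⟩

theorem coneHull_add {E : Type*} [AddCommMonoid E] [Module ℝ E] {S : Set E} {x y : E}
    (hx : x ∈ coneHull S) (hy : y ∈ coneHull S) : x + y ∈ coneHull S := by
  obtain ⟨n, c, v, hc, hv, rfl⟩ := hx
  obtain ⟨m, d, w, hd, hw, rfl⟩ := hy
  refine ⟨n + m, Fin.append c d, Fin.append v w, ?_, ?_, ?_⟩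
  · intro i
    refine Fin.addCases (fun i => ?_) (fun i => ?_) i <;> simp [hc, hd]
  · intro i
    refine Fin.addCases (fun i => ?_) (fun i => ?_) i <;> simp [hv, hw]
  · simp [Fin.sum_univ_add]

theorem coneHull_smul {E : Type*} [AddCommMonoid E] [Module ℝ E] {S : Set E} {x : E} {r : ℝ}
    (hr : 0 ≤ r) (hx : x ∈ coneHull S) : r • x ∈ coneHull S := by
  obtain ⟨n, c, v, hc, hv, rfl⟩ := hx
  exact ⟨n, fun i => r * c i, v, fun i => mul_nonneg hr (hc i), hv, by
    simp [Finset.smul_sum, mul_smul]⟩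

theorem coneHull_sub {E : Type*} [AddCommMonoid E] [Module ℝ E] {S : Set E} {x : E}
    (hx : x ∈ S) : x ∈ coneHull S :=
  ⟨1, fun _ => 1, fun _ => x, by simp, by simp [hx], by simp⟩

theorem coneHull_sum {E : Type*} [AddCommMonoid E] [Module ℝ E] {S : Set E} {ι : Type*}
    (s : Finset ι) (f : ι → E) (hf : ∀ i ∈ s, f i ∈ coneHull S) : ∑ i ∈ s, f i ∈ coneHull S :=
  Finset.sum_induction f (· ∈ coneHull S) (fun _ _ => coneHull_add) (coneHull_zero S) hf

theorem sep_coneHull {X : Type*} [NormedAddCommGroup X] [NormedSpace ℝ X]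
    (S : Set ((X →L[ℝ] ℝ) × ℝ)) (hclosed : IsWeakStarClosedProd (coneHull S))
    (p : X →L[ℝ] ℝ) (α : ℝ) (hp : (p, α) ∉ coneHull S) :
    ∃ (x : X) (r : ℝ), (∀ q ∈ S, q.1 x + q.2 * r ≤ 0) ∧ 0 < p x + α * r := by
  have hconv : Convex ℝ ((fun p : (X →L[ℝ] ℝ) × ℝ => (toWD p.1, p.2)) '' coneHull S) := by
    rintro _ ⟨u, hu, rfl⟩ _ ⟨v, hv, rfl⟩ s t hs ht -
    exact ⟨s • u + t • v, coneHull_add (coneHull_smul hs hu) (coneHull_smul ht hv), rfl⟩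
  have hnot : ((toWD p, α) : WeakDual ℝ X × ℝ) ∉
      ((fun p : (X →L[ℝ] ℝ) × ℝ => (toWD p.1, p.2)) '' coneHull S) := by
    rintro ⟨⟨q, β⟩, hq, h⟩
    have h1 : q = p := congrArg Prod.fst h
    have h2 : β = α := congrArg Prod.snd h
    subst h1 h2
    exact hp hq
  haveI : LocallyConvexSpace ℝ (WeakDual ℝ X) :=
    inferInstanceAs (LocallyConvexSpace ℝ (WeakBilin (topDualPairing ℝ X)))
  obtain ⟨f, u, hu, hfu⟩ := geometric_hahn_banach_closed_point hconv hclosed hnot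
  obtain ⟨x, hx⟩ := LinearMap.dualEmbedding_surjective (topDualPairing ℝ X)
    (f.comp (ContinuousLinearMap.inl ℝ (WeakDual ℝ X) ℝ))
  have hf : ∀ (q : X →L[ℝ] ℝ) (β : ℝ), f (toWD q, β) = q x + β * f (0, 1) := by
    intro q β
    have h1 : ((toWD q, β) : WeakDual ℝ X × ℝ) = (toWD q, 0) + β • (0, 1) := by
      simp
    have h2 : f (toWD q, 0) = q x := (DFunLike.congr_fun hx (toWD q)).symm
    rw [h1, map_add, map_smul, h2, smul_eq_mul]
  have hu0 : 0 < u := by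
    have := hu _ ⟨0, coneHull_zero S, rfl⟩
    have h := hf 0 0
    simp only [Prod.fst_zero, Prod.snd_zero] at this
    rw [h] at this
    simpa using this
  refine ⟨x, f (0, 1), fun q hq => ?_, ?_⟩
  · by_contra! hpos
    set A := q.1 x + q.2 * f (0, 1) with hA
    have := hu _ ⟨(u / A) • q, coneHull_smul (by positivity) (coneHull_sub hq), rfl⟩
    simp only [hf] at this
    simp only [Prod.smul_fst, Prod.smul_snd, ContinuousLinearMap.smul_apply, smul_eq_mul] at this
    have h3 : u / A * q.1 x + u / A * q.2 * f (0, 1) = u := by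
      have : u / A * q.1 x + u / A * q.2 * f (0, 1) = u / A * A := by rw [hA]; ring
      rw [this]; field_simp
    linarith
  · rw [hf] at hfu
    linarith

/-- linear infinite systems, second part: for the inequality system
`Ω = {x | ⟨a t, x⟩ ≤ b t ∀ t}` with `{a t : t ∈ T}` bounded in `X*`, if the cone
`cone{(a t, b t) : t ∈ T}` is weak* closed in `X* × ℝ`, then the normal cone of convex
analysis satisfies `N(xb; Ω) = cone{a t : t ∈ T(xb)}`, where `T(xb) = {t | ⟨a t, xb⟩ = b t}`. -/
theorem statement16 {X T : Type*} [NormedAddCommGroup X] [NormedSpace ℝ X] [CompleteSpace X]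
    (a : T → X →L[ℝ] ℝ) (b : T → ℝ) (xb : X)
    (hbd : ∃ M : ℝ, ∀ t : T, ‖a t‖ ≤ M)
    (hxb : xb ∈ {x : X | ∀ t : T, a t x ≤ b t})
    (hclosed : IsWeakStarClosedProd (coneHull (Set.range fun t : T => (a t, b t)))) :
    convexNormal {x : X | ∀ t : T, a t x ≤ b t} xb =
      coneHull (a '' {t : T | a t xb = b t}) := by
  apply Set.Subset.antisymm
  · intro p hp
    have hp' : ∀ x : X, (∀ t, a t x ≤ b t) → p x ≤ p xb := by
      intro x hx
      have := hp x hx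
      rw [map_sub] at this
      linarith
    have hxb' : ∀ t, a t xb ≤ b t := hxb
    have hmem : (p, p xb) ∈ coneHull (Set.range fun t : T => (a t, b t)) := by
      by_contra hnot
      obtain ⟨x, r, h1, h2⟩ := sep_coneHull _ hclosed p (p xb) hnot
      have h1' : ∀ t, a t x + b t * r ≤ 0 := fun t => h1 _ ⟨t, rfl⟩
      rcases lt_or_ge r 0 with hr | hr
      · have := hp' ((-r)⁻¹ • x) (fun t => by
          have h := h1' t
          rw [map_smul, smul_eq_mul, inv_mul_le_iff₀ (by linarith)]
          linarith)
        rw [map_smul, smul_eq_mul, inv_mul_le_iff₀ (by linarith)] at this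
        linarith
      · have := hp' (xb + (x + r • xb)) (fun t => by
          have h := h1' t
          have h3 := mul_le_mul_of_nonneg_left (hxb' t) hr
          have h4 := hxb' t
          simp only [map_add, map_smul, smul_eq_mul]
          linarith)
        simp only [map_add, map_smul, smul_eq_mul] at this
        linarith
    obtain ⟨n, c, v, hc, hv, hsum⟩ := hmem
    choose t ht using hv
    have e1 : p = ∑ i, c i • a (t i) := by
      have := congrArg Prod.fst hsum
      simpa [Prod.fst_sum, ← ht] using this
    have e2 : p xb = ∑ i, c i * b (t i) := by
      have := congrArg Prod.snd hsum
      simpa [Prod.snd_sum, ← ht] using this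
    have e3 : ∑ i, c i * (b (t i) - a (t i) xb) = 0 := by
      have : p xb = ∑ i, c i * a (t i) xb := by
        conv_lhs => rw [e1]
        simp
      simp only [mul_sub, Finset.sum_sub_distrib]
      linarith
    rw [Finset.sum_eq_zero_iff_of_nonneg
      (fun i _ => mul_nonneg (hc i) (sub_nonneg.2 (hxb' _)))] at e3
    rw [e1]
    refine coneHull_sum _ _ fun i hi => ?_
    rcases mul_eq_zero.1 (e3 i hi) with h | h
    · rw [h, zero_smul]; exact coneHull_zero _
    · exact coneHull_smul (hc i) (coneHull_sub ⟨t i, by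
        simp only [Set.mem_setOf_eq]; linarith, rfl⟩)
  · rintro _ ⟨n, c, v, hc, hv, rfl⟩ x hx
    rw [ContinuousLinearMap.sum_apply]
    refine Finset.sum_nonpos fun i _ => ?_
    obtain ⟨t, ht, hti⟩ := hv i
    rw [← hti]
    have h1 : a t xb = b t := ht
    have h2 : a t x ≤ b t := hx t
    rw [ContinuousLinearMap.smul_apply, map_sub, smul_eq_mul]
    exact mul_nonpos_of_nonneg_of_nonpos (hc i) (by linarith)
end

section
/- Let x̄ be a local minimizer of the infinite program: minimize f(x) subject to g_t(x) ≤ 0 (t ∈ T) and h(x) = 0. Suppose the PMFCQ holds at x̄, the family {g_t}_{t∈T} is uniformly Fréchet differentiable at x̄, and f is Fréchet differentiable at x̄. Then 0 ∈ ∇f(x̄) + ⋂_{ε>0} cl* cone{∇g_t(x̄) : t ∈ T_ε(x̄)} + ∇h(x̄)*(Y*). -/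
open Filter Topology Set Pointwise

theorem aux_lyus {X Y : Type*} [NormedAddCommGroup X] [NormedSpace ℝ X] [CompleteSpace X]
    [NormedAddCommGroup Y] [NormedSpace ℝ Y] [CompleteSpace Y]
    {h : X → Y} {dh : X →L[ℝ] Y} {xb : X} (hhd : HasStrictFDerivAt h dh xb)
    (hsurj : Function.Surjective dh) (h0 : h xb = 0) {d : X} (hd : dh d = 0)
    {κ : ℝ} (hκ : 0 < κ) :
    ∃ s₀ > (0:ℝ), ∀ s, 0 < s → s < s₀ → ∃ x, h x = 0 ∧ ‖x - (xb + s • d)‖ ≤ κ * s := by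
  have hr : dh.range = ⊤ := LinearMap.range_eq_top.2 hsurj
  set R := dh.nonlinearRightInverseOfSurjective hr with hR
  have hRpos : 0 < R.nnnorm := dh.nonlinearRightInverseOfSurjective_nnnorm_pos hr
  have hRpos' : (0:ℝ) < (R.nnnorm : ℝ)⁻¹ := by positivity
  have hD : 0 < ‖d‖ + κ := by positivity
  obtain ⟨c, hc⟩ : ∃ c : NNReal, (c:ℝ) = (R.nnnorm : ℝ)⁻¹ * κ / (‖d‖ + κ) :=
    ⟨⟨(R.nnnorm : ℝ)⁻¹ * κ / (‖d‖ + κ), by positivity⟩, rfl⟩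
  have hc0 : 0 < c := by
    have : (0:ℝ) < c := by rw [hc]; positivity
    exact_mod_cast this
  have hc1 : (c:ℝ) * (‖d‖ + κ) = (R.nnnorm : ℝ)⁻¹ * κ := by
    rw [hc]; field_simp
  obtain ⟨U, hU, hA⟩ := hhd.approximates_deriv_on_nhds (c := c) (Or.inr hc0)
  obtain ⟨r, hr0, hrU⟩ := Metric.mem_nhds_iff.1 hU
  refine ⟨r / (‖d‖ + κ), by positivity, fun s hs hs' => ?_⟩
  rw [lt_div_iff₀ hD] at hs'
  have hsub : Metric.closedBall (xb + s • d) (κ * s) ⊆ U := by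
    intro y hy
    apply hrU
    rw [Metric.mem_closedBall, dist_eq_norm] at hy
    rw [Metric.mem_ball, dist_eq_norm]
    have h1 : y - xb = (y - (xb + s • d)) + s • d := by abel
    have h2 : ‖s • d‖ = s * ‖d‖ := by rw [norm_smul, Real.norm_of_nonneg hs.le]
    calc ‖y - xb‖ ≤ ‖y - (xb + s • d)‖ + ‖s • d‖ := by rw [h1]; exact norm_add_le _ _
      _ < r := by rw [h2]; nlinarith
  have hS := hA.surjOn_closedBall_of_nonlinearRightInverse R (b := xb + s • d)
    (ε := κ * s) (by positivity) hsub
  have hmem : (0:Y) ∈ Metric.closedBall (h (xb + s • d)) (((R.nnnorm : ℝ)⁻¹ - c) * (κ * s)) := by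
    rw [Metric.mem_closedBall, dist_eq_norm, zero_sub, norm_neg]
    have h1 := hA (xb + s • d) (hsub (Metric.mem_closedBall_self (by positivity)))
      xb (mem_of_mem_nhds hU)
    simp only [h0, sub_zero, add_sub_cancel_left, map_smul, hd, smul_zero, norm_smul,
      Real.norm_of_nonneg hs.le] at h1
    nlinarith
  obtain ⟨x, hx, hx0⟩ := hS hmem
  exact ⟨x, hx0, by simpa [Metric.mem_closedBall, dist_eq_norm] using hx⟩

theorem aux_factor {X Y : Type*} [NormedAddCommGroup X] [NormedSpace ℝ X] [CompleteSpace X]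
    [NormedAddCommGroup Y] [NormedSpace ℝ Y] [CompleteSpace Y]
    {dh : X →L[ℝ] Y} (hsurj : Function.Surjective dh) (φ : X →L[ℝ] ℝ)
    (hφ : ∀ v, dh v = 0 → φ v = 0) : ∃ q : Y →L[ℝ] ℝ, q.comp dh = φ := by
  have hr : dh.range = ⊤ := LinearMap.range_eq_top.2 hsurj
  obtain ⟨R⟩ : Nonempty dh.NonlinearRightInverse := ⟨dh.nonlinearRightInverseOfSurjective hr⟩
  have key : ∀ x y, dh x = dh y → φ x = φ y := fun x y hxy => by
    have := hφ (x - y) (by simp [hxy])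
    rw [map_sub] at this; linarith
  have hright : ∀ y, dh (R y) = y := R.right_inv
  let L : Y →ₗ[ℝ] ℝ :=
    { toFun := fun y => φ (R y)
      map_add' := fun x y => by
        rw [← map_add]; apply key; simp [hright]
      map_smul' := fun c y => by
        rw [RingHom.id_apply, ← map_smul]; apply key; simp [hright] }
  refine ⟨L.mkContinuous (‖φ‖ * R.nnnorm) fun y => ?_, ?_⟩
  · calc ‖φ (R y)‖ ≤ ‖φ‖ * ‖R y‖ := φ.le_opNorm _
      _ ≤ ‖φ‖ * (R.nnnorm * ‖y‖) := by gcongr; exact R.bound y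
      _ = _ := by ring
  · ext x
    exact key _ _ (hright _)

theorem aux_cone_add {E : Type*} [AddCommGroup E] [Module ℝ E] {S : Set E} {x y : E}
    (hx : x ∈ coneHull S) (hy : y ∈ coneHull S) : x + y ∈ coneHull S := by
  obtain ⟨n, c, v, hc, hv, rfl⟩ := hx
  obtain ⟨m, c', v', hc', hv', rfl⟩ := hy
  refine ⟨n + m, Fin.append c c', Fin.append v v', ?_, ?_, ?_⟩
  · intro i; refine Fin.addCases ?_ ?_ i <;> intro j <;> simp [hc, hc']
  · intro i; refine Fin.addCases ?_ ?_ i <;> intro j <;> simp [hv, hv']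
  · simp [Fin.sum_univ_add]

theorem aux_cone_smul {E : Type*} [AddCommGroup E] [Module ℝ E] {S : Set E} {x : E}
    (hx : x ∈ coneHull S) {a : ℝ} (ha : 0 ≤ a) : a • x ∈ coneHull S := by
  obtain ⟨n, c, v, hc, hv, rfl⟩ := hx
  exact ⟨n, fun i => a * c i, v, fun i => mul_nonneg ha (hc i), hv, by
    simp [Finset.smul_sum, mul_smul]⟩

theorem aux_bipolar {X : Type*} [NormedAddCommGroup X] [NormedSpace ℝ X]
    {S : Set (X →L[ℝ] ℝ)} {p : X →L[ℝ] ℝ}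
    (hp : ∀ v, (∀ q ∈ S, q v ≤ 0) → p v ≤ 0) : p ∈ wkClosure (coneHull S) := by
  by_contra hn
  have hconv : Convex ℝ (toWD '' coneHull S) := by
    rintro _ ⟨x, hx, rfl⟩ _ ⟨y, hy, rfl⟩ a b ha hb _
    exact ⟨a • x + b • y, aux_cone_add (aux_cone_smul hx ha) (aux_cone_smul hy hb), rfl⟩
  have : LocallyConvexSpace ℝ (WeakDual ℝ X) :=
    (WeakDual.withSeminorms ℝ X).toLocallyConvexSpace
  obtain ⟨F, u, hF, hu⟩ := geometric_hahn_banach_closed_point hconv.closure isClosed_closure hn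
  obtain ⟨v, hv⟩ := LinearMap.dualEmbedding_surjective (B := topDualPairing ℝ X) F
  have hFv : ∀ q : X →L[ℝ] ℝ, F (toWD q) = q v := fun q => by rw [← hv]; rfl
  have hC : ∀ q ∈ coneHull S, q v < u := fun q hq => by
    rw [← hFv]; exact hF _ (subset_closure ⟨q, hq, rfl⟩)
  have h0 : (0 : X →L[ℝ] ℝ) ∈ coneHull S := ⟨0, 0, 0, by simp, by simp, by simp⟩
  have hu0 : 0 < u := by simpa using hC 0 h0
  have hle := hp v fun q hq => by
    by_contra! hpos
    have hqc : q ∈ coneHull S := ⟨1, fun _ => 1, fun _ => q, by simp, by simp [hq], by simp⟩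
    have := hC _ (aux_cone_smul hqc (a := u / q v) (by positivity))
    rw [ContinuousLinearMap.smul_apply, smul_eq_mul, div_mul_cancel₀ _ hpos.ne'] at this
    exact lt_irrefl _ this
  change u < F (toWD p) at hu
  rw [hFv] at hu
  linarith

theorem aux_strict {X Y T : Type*} [NormedAddCommGroup X] [NormedSpace ℝ X] [CompleteSpace X]
    [NormedAddCommGroup Y] [NormedSpace ℝ Y] [CompleteSpace Y]
    (f : X → ℝ) (df : X →L[ℝ] ℝ) (g : T → X → ℝ) (dg : T → X →L[ℝ] ℝ)
    (h : X → Y) (dh : X →L[ℝ] Y) (xb : X)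
    (hhd : HasStrictFDerivAt h dh xb)
    {M : ℝ} (hM0 : 0 ≤ M) (hM : ∀ t : T, ‖dg t‖ ≤ M)
    (hxb : h xb = 0 ∧ ∀ t : T, g t xb ≤ 0)
    (hmin : ∃ ρ > (0:ℝ), ∀ x ∈ {x : X | h x = 0 ∧ ∀ t : T, g t x ≤ 0},
      ‖x - xb‖ < ρ → f xb ≤ f x)
    (hsurj : Function.Surjective dh)
    (hunif : UnifFrechetDiffAt g dg xb)
    (hfd : HasFDerivAt f df xb) {d : X} (hd : dh d = 0) {ε α : ℝ} (hε : 0 < ε) (hα : 0 < α)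
    (hdg : ∀ t, -ε ≤ g t xb → dg t d ≤ -α) : 0 ≤ df d := by
  by_contra! hneg
  obtain ⟨ρ, hρ, hmin⟩ := hmin
  set β := -df d with hβ
  have hβ0 : 0 < β := by linarith
  -- the radius of the correction
  obtain ⟨κ, hκ0, hκ1, hκα, hκβ⟩ : ∃ κ > (0:ℝ), κ ≤ 1 ∧ M * κ ≤ α / 2 ∧ ‖df‖ * κ ≤ β / 4 := by
    refine ⟨min 1 (min (α / (2 * (M + 1))) (β / (4 * (‖df‖ + 1)))), by positivity,
      min_le_left _ _, ?_, ?_⟩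
    · have h1 : min 1 (min (α / (2 * (M + 1))) (β / (4 * (‖df‖ + 1)))) ≤ α / (2 * (M + 1)) :=
        (min_le_right _ _).trans (min_le_left _ _)
      calc _ ≤ (M + 1) * (α / (2 * (M + 1))) := by gcongr; linarith
        _ = _ := by field_simp
    · have h1 : min 1 (min (α / (2 * (M + 1))) (β / (4 * (‖df‖ + 1)))) ≤ β / (4 * (‖df‖ + 1)) :=
        (min_le_right _ _).trans (min_le_right _ _)
      calc _ ≤ (‖df‖ + 1) * (β / (4 * (‖df‖ + 1))) := by gcongr; linarith
        _ = _ := by field_simp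
  set D := ‖d‖ + 1 with hDdef
  have hD : 0 < D := by positivity
  obtain ⟨η, hη, hgη⟩ := hunif (α / (2 * D)) (by positivity)
  have hfo := hfd.isLittleO.def (c := β / (4 * D)) (by positivity)
  obtain ⟨η', hη', hfη⟩ := Metric.eventually_nhds_iff.1 hfo
  obtain ⟨s₀, hs₀, hly⟩ := aux_lyus hhd hsurj hxb.1 hd hκ0
  have hQ : 0 < M * D + α := by positivity
  obtain ⟨s, hs, hss⟩ : ∃ s > (0:ℝ), s < min (min s₀ (ε / (M * D + α)))
      (min (ρ / D) (min (η / D) (η' / D))) := exists_between (by positivity)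
  simp only [lt_min_iff, lt_div_iff₀ hD, lt_div_iff₀ hQ] at hss
  obtain ⟨⟨hs1, hs2⟩, hs3, hs4, hs5⟩ := hss
  obtain ⟨x, hx0, hx⟩ := hly s hs hs1
  have hxe : x - xb = s • d + (x - (xb + s • d)) := by abel
  have hsd : ‖s • d‖ = s * ‖d‖ := by rw [norm_smul, Real.norm_of_nonneg hs.le]
  have hxn : ‖x - xb‖ ≤ s * D := by
    rw [hxe]
    refine (norm_add_le _ _).trans ?_
    rw [hsd]; nlinarith
  set w := x - (xb + s • d) with hw
  have hfeas : ∀ t, g t x ≤ 0 := by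
    intro t
    have h1 := (abs_le.1 (hgη t x (by linarith))).2
    have h2 : α / (2 * D) * ‖x - xb‖ ≤ α / 2 * s := by
      calc _ ≤ α / (2 * D) * (s * D) := by gcongr
        _ = _ := by field_simp
    have hle : ∀ y, dg t y ≤ M * ‖y‖ := fun y =>
      (le_abs_self _).trans (((dg t).le_opNorm y).trans (by gcongr; exact hM t))
    by_cases ht : -ε ≤ g t xb
    · have h3 : dg t (x - xb) = s * dg t d + dg t w := by
        rw [hxe, map_add, map_smul, smul_eq_mul]
      have h4 : dg t w ≤ α / 2 * s := by
        calc dg t w ≤ M * ‖w‖ := hle w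
          _ ≤ M * (κ * s) := by gcongr
          _ = (M * κ) * s := by ring
          _ ≤ _ := by gcongr
      have h5 : s * dg t d ≤ s * (-α) := by gcongr; exact hdg t ht
      have := hxb.2 t
      linarith
    · have h3 : dg t (x - xb) ≤ M * (s * D) := (hle _).trans (by gcongr)
      push Not at ht
      nlinarith
  have hfx := hmin x ⟨hx0, hfeas⟩ (by linarith)
  have h1 := hfη (y := x) (by rw [dist_eq_norm]; linarith)
  rw [Real.norm_eq_abs] at h1
  have h1 := (abs_le.1 h1).2
  have h2 : β / (4 * D) * ‖x - xb‖ ≤ β / 4 * s := by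
    calc _ ≤ β / (4 * D) * (s * D) := by gcongr
      _ = _ := by field_simp
  have h3 : df (x - xb) = s * df d + df w := by
    rw [hxe, map_add, map_smul, smul_eq_mul]
  have h4 : df w ≤ β / 4 * s := by
    calc df w ≤ ‖df‖ * ‖w‖ := (le_abs_self _).trans (df.le_opNorm w)
      _ ≤ ‖df‖ * (κ * s) := by gcongr
      _ = (‖df‖ * κ) * s := by ring
      _ ≤ _ := by gcongr
  have h5 : df d = -β := by rw [hβ]; ring
  rw [h5] at h3
  have : 0 < s * β := by positivity
  linarith

/-- if `xb` is a local minimizer of `f` over the feasible set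
`Ω = {x | h x = 0, g t x ≤ 0 ∀ t}`, the PMFCQ holds at `xb`, `{g t}` is uniformly Fréchet
differentiable at `xb`, and `f` is Fréchet differentiable at `xb`, then
`0 ∈ ∇f(xb) + ⋂_{ε>0} cl* cone{dg t : t ∈ T_ε(xb)} + ∇h(xb)*(Y*)`. -/
theorem statement17 {X Y T : Type*} [NormedAddCommGroup X] [NormedSpace ℝ X] [CompleteSpace X]
    [NormedAddCommGroup Y] [NormedSpace ℝ Y] [CompleteSpace Y]
    (f : X → ℝ) (df : X →L[ℝ] ℝ) (g : T → X → ℝ) (dg : T → X →L[ℝ] ℝ)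
    (h : X → Y) (dh : X →L[ℝ] Y) (xb : X)
    (hgd : ∀ t : T, HasFDerivAt (g t) (dg t) xb)
    (hhd : HasStrictFDerivAt h dh xb)
    (hbd : ∃ M : ℝ, ∀ t : T, ‖dg t‖ ≤ M)
    (hxb : xb ∈ {x : X | h x = 0 ∧ ∀ t : T, g t x ≤ 0})
    (hmin : ∃ ρ > (0:ℝ), ∀ x ∈ {x : X | h x = 0 ∧ ∀ t : T, g t x ≤ 0},
      ‖x - xb‖ < ρ → f xb ≤ f x)
    (hsurj : Function.Surjective dh)
    (hpmfcq : ∃ xt : X, dh xt = 0 ∧ PMFCQat g dg xb xt)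
    (hunif : UnifFrechetDiffAt g dg xb)
    (hfd : HasFDerivAt f df xb) :
    (0 : X →L[ℝ] ℝ) ∈ ({df} : Set (X →L[ℝ] ℝ)) +
      (⋂ ε > (0:ℝ), wkClosure (coneHull (dg '' {t : T | -ε ≤ g t xb}))) + adjRange dh := by
  obtain ⟨M', hM'⟩ := hbd
  obtain ⟨M, hM0, hM⟩ : ∃ M : ℝ, 0 ≤ M ∧ ∀ t, ‖dg t‖ ≤ M :=
    ⟨max M' 0, le_max_right _ _, fun t => (hM' t).trans (le_max_left _ _)⟩
  obtain ⟨xt, hxt, ε₀, hε₀, δ, hδ, hpm⟩ := hpmfcq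
  have strict : ∀ d, dh d = 0 → ∀ ε > (0:ℝ), ∀ α > (0:ℝ),
      (∀ t, -ε ≤ g t xb → dg t d ≤ -α) → 0 ≤ df d := fun d hd ε hε α hα hdg =>
    aux_strict f df g dg h dh xb hhd hM0 hM hxb hmin hsurj hunif hfd hd hε hα hdg
  have hN0 : 0 ≤ df xt := strict xt hxt ε₀ hε₀ δ hδ hpm
  have weak : ∀ d, dh d = 0 → ∀ ε > (0:ℝ),
      (∀ t, -ε ≤ g t xb → dg t d ≤ 0) → 0 ≤ df d := by
    intro d hd ε hε hdg
    have hl : ∀ l > (0:ℝ), 0 ≤ df d + l * df xt := by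
      intro l hl
      have := strict (d + l • xt) (by simp [hd, hxt]) (min ε ε₀) (by positivity) (l * δ)
        (by positivity) (fun t ht => by
          have h1 := hdg t (by linarith [min_le_left ε ε₀])
          have h2 := hpm t (by linarith [min_le_right ε ε₀])
          simp only [map_add, map_smul, smul_eq_mul]
          nlinarith)
      simpa using this
    by_contra! hneg
    have h1 := hl (-df d / (2 * (df xt + 1))) (div_pos (by linarith) (by positivity))
    have h2 : -df d / (2 * (df xt + 1)) * df xt ≤ -df d / 2 := by
      rw [div_mul_eq_mul_div, div_le_div_iff₀ (by positivity) (by norm_num)]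
      nlinarith
    linarith
  -- the sublinear function
  let C : X → Set ℝ := fun v => {c | 0 ≤ c ∧ ∃ ε > (0:ℝ), ∀ t, -ε ≤ g t xb → dg t v ≤ c}
  have hle : ∀ t y, dg t y ≤ M * ‖y‖ := fun t y =>
    (le_abs_self _).trans (((dg t).le_opNorm y).trans (by gcongr; exact hM t))
  have hCM : ∀ v, M * ‖v‖ ∈ C v := fun v => ⟨by positivity, 1, one_pos, fun t _ => hle t v⟩
  have hCb : ∀ v, BddBelow (C v) := fun v => ⟨0, fun c hc => hc.1⟩
  set N := df xt / δ + 1 with hN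
  have hNpos : 0 < N := by positivity
  have hbound : ∀ v, dh v = 0 → ∀ c ∈ C v, -df v ≤ N * c := by
    rintro v hv c ⟨hc, ε, hε, hcv⟩
    have := weak (v + (c / δ) • xt) (by simp [hv, hxt]) (min ε ε₀) (by positivity) (fun t ht => by
      have h1 := hcv t (by linarith [min_le_left ε ε₀])
      have h2 := hpm t (by linarith [min_le_right ε ε₀])
      simp only [map_add, map_smul, smul_eq_mul]
      have h3 : c / δ * dg t xt ≤ c / δ * (-δ) := by gcongr
      have h4 : c / δ * (-δ) = -c := by field_simp
      linarith)
    simp only [map_add, map_smul, smul_eq_mul] at this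
    have h5 : N * c = c / δ * df xt + c := by rw [hN]; field_simp
    linarith
  have hadd : ∀ x y, sInf (C (x + y)) ≤ sInf (C x) + sInf (C y) := by
    intro x y
    have h1 : ∀ a ∈ C x, ∀ b ∈ C y, sInf (C (x + y)) ≤ a + b := by
      rintro a ⟨ha, ε, hε, hae⟩ b ⟨hb, ε', hε', hbe⟩
      refine csInf_le (hCb _) ⟨by positivity, min ε ε', by positivity, fun t ht => ?_⟩
      have h1 := hae t (by linarith [min_le_left ε ε'])
      have h2 := hbe t (by linarith [min_le_right ε ε'])
      rw [map_add]; linarith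
    have h2 : ∀ a ∈ C x, sInf (C (x + y)) - a ≤ sInf (C y) := fun a ha =>
      le_csInf ⟨_, hCM y⟩ fun b hb => by linarith [h1 a ha b hb]
    have h3 : sInf (C (x + y)) - sInf (C y) ≤ sInf (C x) :=
      le_csInf ⟨_, hCM x⟩ fun a ha => by linarith [h2 a ha]
    linarith
  have hsm : ∀ c : ℝ, 0 < c → ∀ x, sInf (C (c • x)) ≤ c * sInf (C x) := by
    intro c hc x
    rw [← div_le_iff₀' hc]
    refine le_csInf ⟨_, hCM x⟩ ?_
    rintro a ⟨ha, ε, hε, hae⟩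
    rw [div_le_iff₀' hc]
    refine csInf_le (hCb _) ⟨by positivity, ε, hε, fun t ht => ?_⟩
    rw [map_smul, smul_eq_mul]
    have := hae t ht
    gcongr
  have hhom : ∀ c : ℝ, 0 < c → ∀ x, sInf (C (c • x)) = c * sInf (C x) := by
    intro c hc x
    refine le_antisymm (hsm c hc x) ?_
    have := hsm c⁻¹ (by positivity) (c • x)
    rw [smul_smul, inv_mul_cancel₀ hc.ne', one_smul] at this
    rwa [← le_inv_mul_iff₀ hc]
  obtain ⟨L, hL1, hL2⟩ := exists_extension_of_le_sublinear
    (⟨LinearMap.ker (dh : X →ₗ[ℝ] Y), (-(df : X →ₗ[ℝ] ℝ)).comp (Submodule.subtype _)⟩ : X →ₗ.[ℝ] ℝ)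
    (fun v => N * sInf (C v))
    (fun c hc x => by simp only [hhom c hc x]; ring)
    (fun x y => by rw [← mul_add]; exact mul_le_mul_of_nonneg_left (hadd x y) hNpos.le)
    (by
      rintro ⟨v, hv⟩
      change -df v ≤ N * sInf (C v)
      rw [← div_le_iff₀' hNpos]
      refine le_csInf ⟨_, hCM v⟩ fun c hc => ?_
      rw [div_le_iff₀' hNpos]
      exact hbound v hv c hc)
  have hLle : ∀ v, ∀ c ∈ C v, L v ≤ N * c := fun v c hc =>
    (hL2 v).trans (mul_le_mul_of_nonneg_left (csInf_le (hCb v) hc) hNpos.le)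
  let p : X →L[ℝ] ℝ := L.mkContinuous (N * M) fun v => by
    rw [Real.norm_eq_abs, abs_le]
    have h1 := hLle v _ (hCM v)
    have h2 := hLle (-v) _ (hCM (-v))
    rw [map_neg, norm_neg] at h2
    constructor <;> linarith
  obtain ⟨q, hq⟩ := aux_factor hsurj (-(df + p)) (fun v hv => by
    have h1 : L v = -df v := hL1 ⟨v, hv⟩
    change -(df v + L v) = 0
    rw [h1]; ring)
  refine Set.mem_add.2 ⟨df + p, Set.add_mem_add rfl ?_, q.comp dh, ⟨q, rfl⟩, by rw [hq]; abel⟩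
  refine Set.mem_iInter₂.2 fun ε hε => aux_bipolar fun v hv => ?_
  have := hLle v 0 ⟨le_rfl, ε, hε, fun t ht => hv _ ⟨t, ht, rfl⟩⟩
  rw [mul_zero] at this
  exact this
end
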